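/- arXiv:0906.0157 — 5 statements merged into one kernel-verified Lean document; each statement's English description precedes it below -/
import Mathlib

section
/- Let 𝕂 be an algebraically closed field of characteristic 0 and 𝒜 an associative unital 𝕂-algebra equipped with an increasing exhaustive filtration F₀𝒜 ⊆ F₁𝒜 ⊆ ⋯ (so Fᵢ𝒜·Fⱼ𝒜 ⊆ F_{i+j}𝒜, 1 ∈ F₀𝒜, ⋃ᵢ Fᵢ𝒜 = 𝒜) such that the associated graded algebra A := gr 𝒜 = ⊕ᵢ Fᵢ𝒜/F_{i−1}𝒜 is finitely generated over 𝕂, and suppose there is an integer d > 0 with [Fᵢ𝒜, Fⱼ𝒜] ⊆ F_{i+j−d}𝒜 for all i, j. Then A is commutative and carries the canonical Poisson bracket determined by {a + F_{i−1}𝒜, b + F_{j−1}𝒜} := [a,b] + F_{i+j−d−1}𝒜 for a ∈ Fᵢ𝒜, b ∈ Fⱼ𝒜. Let I := A·{A,A} be the ideal of A generated by all Poisson brackets of pairs of elements of A, and for a positive integer n let ℐ_n ⊆ 𝒜 be the two-sided ideal generated by all values s_{2n}(a₁,…,a_{2n}) of the standard polynomial, with induced ideal gr ℐ_n := ⊕ᵢ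 (ℐ_n ∩ Fᵢ𝒜 + F_{i−1}𝒜)/F_{i−1}𝒜 of A. Then the radical √(gr ℐ_n) contains I. -/
open scoped BigOperators

/-- The standard polynomial `s_n(x₁, …, x_n) = ∑_{σ ∈ S_n} sgn(σ) x_{σ(1)} ⋯ x_{σ(n)}`. -/
noncomputable def standardPolynomial {R : Type*} [Ring R] (n : ℕ) (x : Fin n → R) : R :=
  ∑ σ : Equiv.Perm (Fin n), (Equiv.Perm.sign σ : ℤ) • (List.ofFn fun i => x (σ i)).prod

/-- The standard polynomial as a multilinear map. -/
noncomputable def standardMultilinear (k : Type*) [CommRing k] (R : Type*) [Ring R] [Algebra k R]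
    (m : ℕ) : MultilinearMap k (fun _ : Fin m => R) R :=
  ∑ σ : Equiv.Perm (Fin m),
    (Equiv.Perm.sign σ : ℤ) • (MultilinearMap.mkPiAlgebraFin k m R).domDomCongr σ

theorem standardMultilinear_apply (k : Type*) [CommRing k] {R : Type*} [Ring R] [Algebra k R]
    {m : ℕ} (x : Fin m → R) : standardMultilinear k R m x = standardPolynomial m x := by
  simp [standardMultilinear, standardPolynomial]

theorem MultilinearMap.mem_of_forall_mem_span {k M N ι : Type*} [CommRing k] [AddCommGroup M]
    [Module k M] [AddCommGroup N] [Module k N] [Finite ι]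
    (f : MultilinearMap k (fun _ : ι => M) N) (G : ι → Set M) (N' : Submodule k N)
    (h : ∀ x : ι → M, (∀ i, x i ∈ G i) → f x ∈ N')
    (x : ι → M) (hx : ∀ i, x i ∈ Submodule.span k (G i)) : f x ∈ N' := by
  classical
  have := Fintype.ofFinite ι
  suffices H : ∀ s : Finset ι, ∀ x : ι → M, (∀ i ∈ s, x i ∈ Submodule.span k (G i)) →
      (∀ i ∉ s, x i ∈ G i) → f x ∈ N' from
    H Finset.univ x (fun i _ => hx i) (fun i hi => absurd (Finset.mem_univ i) hi)
  intro s
  induction s using Finset.induction_on with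
  | empty => exact fun x _ hx => h x fun i => hx i (Finset.notMem_empty i)
  | insert j s hj ih =>
    intro x hs hG
    suffices H : ∀ y ∈ Submodule.span k (G j), f (Function.update x j y) ∈ N' by
      simpa using H (x j) (hs j (Finset.mem_insert_self j s))
    intro y hy
    induction hy using Submodule.span_induction with
    | mem y hy =>
      refine ih _ (fun i hi => ?_) (fun i hi => ?_)
      · have : i ≠ j := fun e => hj (e ▸ hi)
        simpa [this] using hs i (Finset.mem_insert_of_mem hi)
      · by_cases e : i = j
        · subst e; simpa using hy
        · simpa [e] using hG i (by simp [e, hi])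
    | zero => simp
    | add y z _ _ hy hz => simpa using N'.add_mem hy hz
    | smul c y _ hy => simpa using N'.smul_mem c hy

theorem standardPolynomial_mulLeft_mul_ad_pow_apply_mem {k R : Type*} [CommRing k] [Ring R]
    [Algebra k R]
    (I : TwoSidedIdeal R) (m : ℕ) (hI : ∀ v : Fin m → R, standardPolynomial m v ∈ I)
    (a : R) (b : Fin m → R) (q : Fin m → ℕ) (w : R) :
    standardPolynomial (R := Module.End k R) m (fun i => LinearMap.mulLeft k (b i) *
      (LinearMap.mulRight k a - LinearMap.mulLeft k a) ^ q i) w ∈ I := by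
  have hsm : ∀ (c : k) (x : R), x ∈ I → c • x ∈ I := fun c x hx => by
    rw [← one_mul x, ← smul_mul_assoc]; exact I.mul_mem_left _ _ hx
  let N : Submodule k (Module.End k R) :=
    { carrier := {Z | ∀ w, Z w ∈ I}
      add_mem' := fun ha hb w => I.add_mem (ha w) (hb w)
      zero_mem' := fun w => I.zero_mem
      smul_mem' := fun c Z hZ w => hsm c _ (hZ w) }
  let G : Set (Module.End k R) :=
    {Z | ∃ y r, Z = LinearMap.mulLeft k y * LinearMap.mulRight k a ^ r}
  have hcomm : ∀ y : R, ∀ r : ℕ,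
      Commute (LinearMap.mulRight k a ^ r) (LinearMap.mulLeft k y) := fun y r => by
    refine Commute.pow_left ?_ r
    ext z
    simp [mul_assoc]
  have hprod : ∀ (y : Fin m → R) (r : Fin m → ℕ) (l : List (Fin m)),
      (l.map fun i => LinearMap.mulLeft k (y i) * LinearMap.mulRight k a ^ r i).prod =
        LinearMap.mulLeft k (l.map y).prod * LinearMap.mulRight k a ^ (l.map r).sum := by
    intro y r l
    induction l with
    | nil => ext; simp
    | cons i l ih =>
      simp only [List.map_cons, List.prod_cons, List.sum_cons, ih, LinearMap.mulLeft_mul, pow_add]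
      have := (hcomm (l.map y).prod (r i)).eq
      change _ = (LinearMap.mulLeft k (y i) * LinearMap.mulLeft k _) * _
      simp only [mul_assoc]
      rw [← mul_assoc (_ ^ r i), this, mul_assoc]
  have key := MultilinearMap.mem_of_forall_mem_span (standardMultilinear k (Module.End k R) m)
    (fun _ => G) N ?_ (fun i => LinearMap.mulLeft k (b i) *
      (LinearMap.mulRight k a - LinearMap.mulLeft k a) ^ q i) ?_
  · rw [standardMultilinear_apply] at key
    exact key w
  · intro x hx w
    choose y r hyr using hx
    obtain rfl : x = fun i => LinearMap.mulLeft k (y i) * LinearMap.mulRight k a ^ r i :=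
      funext hyr
    rw [standardMultilinear_apply]
    have : standardPolynomial (R := Module.End k R) m
        (fun i => LinearMap.mulLeft k (y i) * LinearMap.mulRight k a ^ r i) =
        LinearMap.mulLeft k (standardPolynomial m y) * LinearMap.mulRight k a ^ (∑ i, r i) := by
      have hσ : ∀ σ : Equiv.Perm (Fin m), (List.ofFn fun i => (LinearMap.mulLeft k (y (σ i)) *
          LinearMap.mulRight k a ^ r (σ i) : Module.End k R)).prod =
          LinearMap.mulLeft k (List.ofFn fun i => y (σ i)).prod *
            LinearMap.mulRight k a ^ (∑ i, r i) := by
        intro σ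
        have := hprod y r (List.ofFn σ)
        rw [List.map_ofFn, List.map_ofFn, List.map_ofFn, List.sum_ofFn] at this
        rw [← Equiv.sum_comp σ r]
        exact this
      ext z
      simp only [standardPolynomial, hσ]
      simp [Finset.sum_mul, mul_assoc]
    rw [this]
    exact I.mul_mem_right _ _ (hI y)
  · intro i
    suffices H : ∀ q : ℕ, ∀ y : R, LinearMap.mulLeft k y *
        (LinearMap.mulRight k a - LinearMap.mulLeft k a) ^ q ∈ Submodule.span k G from H _ _
    intro q
    induction q with
    | zero => exact fun y => Submodule.subset_span ⟨y, 0, rfl⟩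
    | succ q ih =>
      intro y
      rw [pow_succ, ← mul_assoc]
      suffices H : Submodule.span k G ≤ (Submodule.span k G).comap
          (LinearMap.mulRight k (LinearMap.mulRight k a - LinearMap.mulLeft k a)) from H (ih y)
      refine Submodule.span_le.2 ?_
      rintro _ ⟨y, r, rfl⟩
      have : (LinearMap.mulLeft k y * LinearMap.mulRight k a ^ r : Module.End k R) *
          (LinearMap.mulRight k a - LinearMap.mulLeft k a) =
          LinearMap.mulLeft k y * LinearMap.mulRight k a ^ (r + 1) -
          LinearMap.mulLeft k (y * a) * LinearMap.mulRight k a ^ r := by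
        rw [mul_sub, mul_assoc, mul_assoc, (hcomm a r).eq, ← pow_succ, LinearMap.mulLeft_mul,
          ← mul_assoc]
        rfl
      simp only [SetLike.mem_coe, Submodule.mem_comap, LinearMap.mulRight_apply, this]
      exact Submodule.sub_mem _ (Submodule.subset_span ⟨_, _, rfl⟩)
        (Submodule.subset_span ⟨_, _, rfl⟩)

/-- The word in the operators `x ↦ u ^ (k + 1) * D^k x` with exponents `k` listed in `l`,
applied to `1`. -/
noncomputable def derivationWord {k A : Type*} [CommRing k] [CommRing A] [Algebra k A]
    (D : Derivation k A A) (u : A) (l : List ℕ) : A :=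
  (l.map fun r => (LinearMap.mulLeft k (u ^ (r + 1)) * (D : A →ₗ[k] A) ^ r :
    Module.End k A)).prod 1

section DerivationWord

variable {k A : Type*} [CommRing k] [CommRing A] [Algebra k A] (D : Derivation k A A) (u : A)

theorem derivationWord_cons (r : ℕ) (l : List ℕ) :
    derivationWord D u (r :: l) = u ^ (r + 1) * D^[r] (derivationWord D u l) := by
  simp [derivationWord, Module.End.pow_apply]

theorem Derivation.pow_sub_dvd_iterate (r : ℕ) {s : ℕ} {x : A} (h : u ^ s ∣ x) :
    u ^ (s - r) ∣ D^[r] x := by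
  induction r with
  | zero => simpa using h
  | succ r ih =>
    rw [Function.iterate_succ_apply']
    obtain ⟨y, hy⟩ := ih
    rw [hy, Derivation.leibniz, Derivation.leibniz_pow, ← Nat.sub_sub]
    simp only [smul_eq_mul, nsmul_eq_mul]
    exact dvd_add (((pow_dvd_pow u (Nat.sub_le _ _))).mul_right _)
      (Dvd.dvd.mul_left (Dvd.dvd.mul_left (dvd_mul_right _ _) _) _)

theorem Derivation.exists_iterate_pow_mul (r : ℕ) (x : A) :
    ∃ y, D^[r] (u ^ r * x) = r.factorial * D u ^ r * x + u * y := by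
  induction r generalizing x with
  | zero => exact ⟨0, by simp⟩
  | succ r ih =>
    obtain ⟨y, hy⟩ := ih ((r + 1) * D u * x + u * D x)
    refine ⟨y + r.factorial * D u ^ r * D x, ?_⟩
    have : D (u ^ (r + 1) * x) = u ^ r * ((r + 1) * D u * x + u * D x) := by
      rw [Derivation.leibniz, Derivation.leibniz_pow]
      simp only [smul_eq_mul, nsmul_eq_mul, Nat.add_sub_cancel]
      push_cast; ring
    rw [Function.iterate_succ_apply, this, hy, Nat.factorial_succ]
    push_cast; ring

theorem pow_length_dvd_derivationWord (l : List ℕ) :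
    u ^ l.length ∣ derivationWord D u l := by
  induction l with
  | nil => simp
  | cons r l ih =>
    rw [derivationWord_cons]
    refine dvd_trans (pow_dvd_pow u ?_)
      (pow_add u (r + 1) (l.length - r) ▸ mul_dvd_mul_left _ (D.pow_sub_dvd_iterate u r ih))
    simp; omega

theorem pow_dvd_derivationWord_ofFn {m : ℕ} (f : Fin m → ℕ) (hf : ∃ i : Fin m, m - 1 - i < f i) :
    u ^ (m + 1) ∣ derivationWord D u (List.ofFn f) := by
  induction m with
  | zero => exact hf.choose.elim0
  | succ m ih =>
    obtain ⟨i, hi⟩ := hf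
    rw [List.ofFn_succ, derivationWord_cons]
    cases i using Fin.cases with
    | zero => exact (pow_dvd_pow u (by simp at hi; omega)).mul_right _
    | succ i =>
      have h := ih (fun i => f i.succ) ⟨i, by simp at hi; omega⟩
      refine dvd_trans (pow_dvd_pow u ?_)
        (pow_add u (f 0 + 1) (m + 1 - f 0) ▸ mul_dvd_mul_left _ (D.pow_sub_dvd_iterate u (f 0) h))
      omega

theorem exists_derivationWord_ofFn_rev (m : ℕ) :
    ∃ N : ℕ, N ≠ 0 ∧ ∃ K : ℕ, ∃ y : A,
      derivationWord D u (List.ofFn fun i : Fin m => m - 1 - i) =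
        u ^ m * (N * D u ^ K + u * y) := by
  induction m with
  | zero => exact ⟨1, one_ne_zero, 0, 0, by simp [derivationWord]⟩
  | succ m ih =>
    obtain ⟨N, hN, K, y, h⟩ := ih
    obtain ⟨z, hz⟩ := D.exists_iterate_pow_mul u m (N * D u ^ K + u * y)
    refine ⟨m.factorial * N, mul_ne_zero m.factorial_ne_zero hN, m + K,
      z + m.factorial * D u ^ m * y, ?_⟩
    have e : ∀ i : Fin m, m + 1 - 1 - (i.succ : ℕ) = m - 1 - i := fun i => by simp; omega
    rw [List.ofFn_succ, derivationWord_cons]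
    simp only [e]
    simp only [h, Fin.val_zero, Nat.add_sub_cancel, Nat.sub_zero, hz]
    push_cast; ring

theorem Equiv.Perm.eq_one_of_forall_le {m : ℕ} (σ : Equiv.Perm (Fin m)) (h : ∀ i, i ≤ σ i) :
    σ = 1 := by
  have h2 := (Finset.sum_eq_sum_iff_of_le (s := Finset.univ) (f := fun i : Fin m => (i : ℕ))
    (g := fun i => (σ i : ℕ)) fun i _ => h i).1 (Equiv.sum_comp σ fun i : Fin m => (i : ℕ)).symm
  exact Equiv.ext fun i => Fin.ext (h2 i (Finset.mem_univ i)).symm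

end DerivationWord

theorem Derivation.apply_mem_radical_of_standardPolynomial_mem {k A : Type*} [Field k]
    [IsAlgClosed k] [CharZero k] [CommRing A] [Algebra k A] [Algebra.FiniteType k A]
    (D : Derivation k A A) (J : Ideal A) (hDJ : ∀ x ∈ J, D x ∈ J) (m : ℕ)
    (hJ : ∀ f : Fin m → A, standardPolynomial (R := Module.End k A) m
      (fun i => LinearMap.mulLeft k (f i) * (D : A →ₗ[k] A) ^ (m - 1 - i : ℕ)) 1 ∈ J)
    (b : A) : D b ∈ J.radical := by
  have : IsJacobsonRing A := isJacobsonRing_of_finiteType (A := k)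
  rw [Ideal.radical_eq_jacobson, Ideal.jacobson, Ideal.mem_sInf]
  rintro 𝔫 ⟨hJ𝔫, h𝔫⟩
  have hp := h𝔫.isPrime
  let _ := Ideal.Quotient.field 𝔫
  have : Module.Finite k (A ⧸ 𝔫) := finite_of_finite_type_of_isJacobsonRing k (A ⧸ 𝔫)
  obtain ⟨s, hs⟩ := (IsAlgClosed.algebraMap_bijective_of_isIntegral (k := k) (K := A ⧸ 𝔫)).2
    (Ideal.Quotient.mk 𝔫 b)
  let u := b - algebraMap k A s
  have hu : u ∈ 𝔫 := by
    rw [← Ideal.Quotient.eq_zero_iff_mem, map_sub, ← hs]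
    exact sub_self _
  have hDu : D u = D b := by simp [u]
  have hcast : ∀ N : ℕ, N ≠ 0 → (N : A) ∉ 𝔫 := fun N hN h => by
    refine hp.ne_top (Ideal.eq_top_of_isUnit_mem _ h ?_)
    have := (IsUnit.mk0 (N : k) (Nat.cast_ne_zero.2 hN)).map (algebraMap k A)
    rwa [_root_.map_natCast] at this
  have hword : ∀ σ : Equiv.Perm (Fin m), (List.ofFn fun i =>
      (LinearMap.mulLeft k (u ^ (m - 1 - σ i + 1 : ℕ)) * (D : A →ₗ[k] A) ^ (m - 1 - σ i : ℕ) :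
        Module.End k A)).prod 1 = derivationWord D u (List.ofFn fun i => (m - 1 - σ i : ℕ)) := by
    intro σ
    rw [derivationWord, List.map_ofFn]
    rfl
  have hdvd : u ^ (m + 1) ∣ ∑ σ ∈ Finset.univ.erase (1 : Equiv.Perm (Fin m)),
      (Equiv.Perm.sign σ : ℤ) • derivationWord D u (List.ofFn fun i => (m - 1 - σ i : ℕ)) := by
    refine Finset.dvd_sum fun σ hσ => ?_
    rw [zsmul_eq_mul]
    refine Dvd.dvd.mul_left (pow_dvd_derivationWord_ofFn D u _ ?_) _
    by_contra! hle
    refine (Finset.mem_erase.1 hσ).1 (σ.eq_one_of_forall_le fun i => ?_)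
    have := hle i
    simp only [Fin.le_def]
    omega
  obtain ⟨z, hz⟩ := hdvd
  obtain ⟨N, hN, K, y, hy⟩ := exists_derivationWord_ofFn_rev D u m
  have hmem := hJ fun i => u ^ (m - 1 - i + 1 : ℕ)
  simp only [standardPolynomial, LinearMap.sum_apply, LinearMap.smul_apply, hword] at hmem
  rw [← Finset.add_sum_erase _ _ (Finset.mem_univ 1), hz] at hmem
  simp only [Equiv.Perm.sign_one, Units.val_one, one_smul, Equiv.Perm.coe_one, id_eq, hy] at hmem
  have hiter : ∀ r : ℕ, ∀ x ∈ J, D^[r] x ∈ J := fun r => by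
    induction r with
    | zero => exact fun x hx => hx
    | succ r ih => exact fun x hx => ih _ (hDJ x hx)
  obtain ⟨w, hw⟩ := D.exists_iterate_pow_mul u m (N * D u ^ K + u * y + u * z)
  have hmem' : (m.factorial * D u ^ m * (N * D u ^ K + u * y + u * z) + u * w) ∈ 𝔫 := by
    rw [← hw]
    refine hJ𝔫 (hiter m _ ?_)
    convert hmem using 1
    ring
  have hmain : (m.factorial * N : ℕ) * D u ^ (m + K) ∈ 𝔫 := by
    have := 𝔫.sub_mem hmem' (𝔫.mul_mem_right (m.factorial * D u ^ m * (y + z) + w) hu)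
    convert this using 1
    push_cast
    ring
  rw [← hDu]
  exact hp.mem_of_pow_mem _ ((hp.mem_or_mem hmain).resolve_left
    (hcast _ (mul_ne_zero m.factorial_ne_zero hN)))

/-- Let `𝒜` be a filtered associative unital algebra over an algebraically closed field `𝕜` of
characteristic `0`, with `[Fᵢ𝒜, Fⱼ𝒜] ⊆ F_{i+j-d}𝒜` for a fixed `d > 0`, and let `A = gr 𝒜`
(presented here by the data `(A, φ)`: surjections `φ i : Fᵢ𝒜 → Aᵢ` with kernel `F_{i-1}𝒜`
realizing `A` as the internal direct sum of the `Aᵢ`), a finitely generated commutative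
`𝕜`-algebra with the canonical Poisson bracket `β` induced by the commutator.  Let
`I = A·{A,A}` and let `ℐ_n ⊆ 𝒜` be the two-sided ideal generated by the values of the standard
polynomial `s_{2n}`, with induced ideal `gr ℐ_n ⊆ A`.  Then `I ⊆ √(gr ℐ_n)`. -/
theorem poisson_ideal_le_radical_of_graded_standard_ideal
    (𝕜 : Type*) [Field 𝕜] [IsAlgClosed 𝕜] [CharZero 𝕜]
    (𝓐 : Type*) [Ring 𝓐] [Algebra 𝕜 𝓐]
    -- the filtration
    (F : ℤ → Submodule 𝕜 𝓐)
    (hmono : Monotone F)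
    (hexh : ∀ a : 𝓐, ∃ i, a ∈ F i)
    (hneg : ∀ i : ℤ, i < 0 → F i = ⊥)
    (hone : (1 : 𝓐) ∈ F 0)
    (hmul : ∀ i j : ℤ, ∀ a ∈ F i, ∀ b ∈ F j, a * b ∈ F (i + j))
    (d : ℤ) (hd : 0 < d)
    (hcomm : ∀ i j : ℤ, ∀ a ∈ F i, ∀ b ∈ F j, a * b - b * a ∈ F (i + j - d))
    -- the associated graded algebra `A = gr 𝒜 = ⊕ᵢ Fᵢ𝒜/F_{i-1}𝒜`, a commutative algebra,
    -- presented via the maps `φ i : Fᵢ𝒜 → A` with kernel `F_{i-1}𝒜`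
    (A : Type*) [CommRing A] [Algebra 𝕜 A]
    (φ : ∀ i : ℤ, F i →ₗ[𝕜] A)
    (hinternal : DirectSum.IsInternal fun i : ℤ => LinearMap.range (φ i))
    (hker : ∀ (i : ℤ) (x : F i), φ i x = 0 ↔ (x : 𝓐) ∈ F (i - 1))
    (hφone : φ 0 ⟨1, hone⟩ = 1)
    (hφmul : ∀ (i j : ℤ) (a : F i) (b : F j),
      φ i a * φ j b = φ (i + j) ⟨(a : 𝓐) * b, hmul i j a a.2 b b.2⟩)
    (hφalg : ∀ c : 𝕜, algebraMap 𝕜 A c = φ 0 ⟨c • (1 : 𝓐), (F 0).smul_mem c hone⟩)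
    -- `A` is finitely generated over `𝕜`
    (hfg : Algebra.FiniteType 𝕜 A)
    -- the canonical Poisson bracket on `A`, induced by the commutator of `𝒜`
    (β : A →ₗ[𝕜] A →ₗ[𝕜] A)
    (hβ : ∀ (i j : ℤ) (a : F i) (b : F j),
      β (φ i a) (φ j b) = φ (i + j - d) ⟨(a : 𝓐) * b - (b : 𝓐) * a, hcomm i j a a.2 b b.2⟩)
    -- a positive integer `n`
    (n : ℕ) (hn : 0 < n) :
    Ideal.span {z : A | ∃ x y : A, z = β x y} ≤
      (Ideal.span (⋃ i : ℤ, φ i '' {x : F i |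
        (x : 𝓐) ∈ TwoSidedIdeal.span
          {z : 𝓐 | ∃ v : Fin (2 * n) → 𝓐, z = standardPolynomial (2 * n) v}})).radical := by
  let Φ : ℤ → 𝓐 → A → Prop := fun i x y => ∃ h : x ∈ F i, φ i ⟨x, h⟩ = y
  have hΦzero : ∀ i, Φ i 0 0 := fun i => ⟨(F i).zero_mem, (φ i).map_zero⟩
  have hΦadd : ∀ {i x x' y y'}, Φ i x y → Φ i x' y' → Φ i (x + x') (y + y') := by
    rintro i x x' _ _ ⟨h, rfl⟩ ⟨h', rfl⟩
    exact ⟨(F i).add_mem h h', (φ i).map_add ⟨x, h⟩ ⟨x', h'⟩⟩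
  have hΦsmul : ∀ (c : ℤ) {i x y}, Φ i x y → Φ i (c • x) (c • y) := by
    rintro c i x _ ⟨h, rfl⟩
    exact ⟨zsmul_mem h c, map_zsmul (φ i) c ⟨x, h⟩⟩
  have hΦsum : ∀ {ι : Type} (s : Finset ι) {i : ℤ} {x : ι → 𝓐} {y : ι → A},
      (∀ j, Φ i (x j) (y j)) → Φ i (∑ j ∈ s, x j) (∑ j ∈ s, y j) := by
    intro ι s i x y h
    classical
    induction s using Finset.induction_on with
    | empty => simpa using hΦzero i
    | insert j s hj ih => rw [Finset.sum_insert hj, Finset.sum_insert hj]; exact hΦadd (h j) ih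
  have hΦmul : ∀ {i j x x' y y'}, Φ i x y → Φ j x' y' → Φ (i + j) (x * x') (y * y') := by
    rintro i j x x' _ _ ⟨h, rfl⟩ ⟨h', rfl⟩
    exact ⟨hmul i j x h x' h', (hφmul i j ⟨x, h⟩ ⟨x', h'⟩).symm⟩
  have hΦcomm : ∀ {i j x x' y y'}, Φ i x y → Φ j x' y' →
      Φ (i + j - d) (x * x' - x' * x) (β y y') := by
    rintro i j x x' _ _ ⟨h, rfl⟩ ⟨h', rfl⟩
    exact ⟨hcomm i j x h x' h', (hβ i j ⟨x, h⟩ ⟨x', h'⟩).symm⟩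
  have hΦunique : ∀ {i j x y y'}, i = j → Φ i x y → Φ j x y' → y = y' := by
    rintro i _ x _ _ rfl ⟨h, rfl⟩ ⟨h', rfl⟩
    rfl
  have hΦone : Φ 0 1 1 := ⟨hone, hφone⟩
  let H : Set A := {y | ∃ i x, Φ i x y}
  have hspan : ∀ y : A, y ∈ Submodule.span 𝕜 H := by
    have : (⊤ : Submodule 𝕜 A) ≤ Submodule.span 𝕜 H := by
      rw [← hinternal.submodule_iSup_eq_top]
      refine iSup_le fun i => ?_
      rintro _ ⟨x, rfl⟩
      exact Submodule.subset_span ⟨i, x, x.2, rfl⟩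
    exact fun y => this trivial
  set 𝓘 := TwoSidedIdeal.span {z : 𝓐 | ∃ v : Fin (2 * n) → 𝓐, z = standardPolynomial (2 * n) v}
  set J : Ideal A := Ideal.span (⋃ i : ℤ, φ i '' {x : F i | (x : 𝓐) ∈ 𝓘})
  have hmemJ : ∀ {i x y}, Φ i x y → x ∈ 𝓘 → y ∈ J := by
    rintro i x _ ⟨h, rfl⟩ hx
    exact Ideal.subset_span (Set.mem_iUnion.2 ⟨i, ⟨x, h⟩, hx, rfl⟩)
  rw [Ideal.span_le]
  rintro _ ⟨b, y, rfl⟩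
  suffices hhom : ∀ y ∈ H, ∀ b, β b y ∈ J.radical by
    refine Submodule.span_induction (p := fun y _ => β b y ∈ J.radical) (fun y hy => hhom y hy b)
      ?_ ?_ ?_ (hspan y)
    · simp
    · intro y z _ _ hy hz
      rw [map_add]
      exact add_mem hy hz
    · intro c y _ hy
      rw [map_smul, Algebra.smul_def]
      exact Ideal.mul_mem_left _ _ hy
  clear b y
  rintro y ⟨e, a, ha⟩ b
  have hleib : ∀ x z : A, β (x * z) y = x * β z y + z * β x y := by
    intro x z
    refine Submodule.span_induction (p := fun x _ => β (x * z) y = x * β z y + z * β x y)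
      ?_ ?_ ?_ ?_ (hspan x)
    · rintro x ⟨i, x', hx⟩
      refine Submodule.span_induction (p := fun z _ => β (x * z) y = x * β z y + z * β x y)
        ?_ ?_ ?_ ?_ (hspan z)
      · rintro z ⟨j, z', hz⟩
        have h₁ := hΦcomm (hΦmul hx hz) ha
        have h₂ := hΦmul hx (hΦcomm hz ha)
        have h₃ := hΦmul (hΦcomm hx ha) hz
        rw [show i + (j + e - d) = i + j + e - d by ring] at h₂
        rw [show i + e - d + j = i + j + e - d by ring] at h₃
        have h₄ := hΦadd h₂ h₃
        rw [show x' * (z' * a - a * z') + (x' * a - a * x') * z' = x' * z' * a - a * (x' * z') by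
          noncomm_ring] at h₄
        rw [hΦunique rfl h₁ h₄, mul_comm z]
      · simp
      · intro z w _ _ hz hw
        simp only [mul_add, map_add, LinearMap.add_apply, hz, hw]
        ring
      · intro c z _ hz
        simp only [mul_smul_comm, map_smul, LinearMap.smul_apply, hz, smul_mul_assoc, smul_add]
    · simp
    · intro x w _ _ hx hw
      simp only [add_mul, map_add, LinearMap.add_apply, hx, hw, mul_add]
      ring
    · intro c x _ hx
      simp only [smul_mul_assoc, map_smul, LinearMap.smul_apply, hx, smul_add, mul_smul_comm]
  let D : Derivation 𝕜 A A := Derivation.mk' (β.flip y) fun x z => by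
    simpa [smul_eq_mul] using hleib x z
  have hD : ∀ x, D x = β x y := fun x => rfl
  have hDJ : ∀ x ∈ J, D x ∈ J := by
    intro x hx
    refine Submodule.span_induction (p := fun x _ => D x ∈ J) ?_ ?_ ?_ ?_ hx
    · rintro _ hx
      obtain ⟨i, ⟨x, hxi⟩, hx𝓘, rfl⟩ := Set.mem_iUnion.1 hx
      exact hmemJ (hΦcomm ⟨hxi, rfl⟩ ha)
        (𝓘.sub_mem (𝓘.mul_mem_right _ _ hx𝓘) (𝓘.mul_mem_left _ _ hx𝓘))
    · simp
    · intro x z _ _ hx hz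
      rw [map_add]
      exact J.add_mem hx hz
    · intro c x hx' hx
      rw [smul_eq_mul, Derivation.leibniz]
      exact J.add_mem (J.mul_mem_left _ hx) (J.mul_mem_right _ hx')
  refine D.apply_mem_radical_of_standardPolynomial_mem J hDJ (2 * n) (fun f => ?_) b
  let N : Submodule 𝕜 (Module.End 𝕜 A) :=
    (J.restrictScalars 𝕜).comap (LinearMap.applyₗ (1 : A))
  let G : Fin (2 * n) → Set (Module.End 𝕜 A) := fun i =>
    {Z | ∃ g ∈ H, Z = LinearMap.mulLeft 𝕜 g * (D : A →ₗ[𝕜] A) ^ (2 * n - 1 - i : ℕ)}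
  have key := MultilinearMap.mem_of_forall_mem_span
    (standardMultilinear 𝕜 (Module.End 𝕜 A) (2 * n)) G N ?_
    (fun i => LinearMap.mulLeft 𝕜 (f i) * (D : A →ₗ[𝕜] A) ^ (2 * n - 1 - i : ℕ)) ?_
  · rw [standardMultilinear_apply] at key
    exact key
  · intro Z hZ
    choose g hg hZg using hZ
    obtain rfl := funext hZg
    choose deg b' hb' using hg
    rw [standardMultilinear_apply]
    let T : Fin (2 * n) → Module.End 𝕜 𝓐 := fun i => LinearMap.mulLeft 𝕜 (b' i) *
      (LinearMap.mulRight 𝕜 a - LinearMap.mulLeft 𝕜 a) ^ (2 * n - 1 - i : ℕ)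
    let t : Fin (2 * n) → Module.End 𝕜 A := fun i => LinearMap.mulLeft 𝕜 (g i) *
      (D : A →ₗ[𝕜] A) ^ (2 * n - 1 - i : ℕ)
    let shift : Fin (2 * n) → ℤ := fun i => deg i + (2 * n - 1 - i : ℕ) * (e - d)
    have hpow : ∀ (r : ℕ) {i x z}, Φ i x z → Φ (r * (e - d) + i)
        (((LinearMap.mulRight 𝕜 a - LinearMap.mulLeft 𝕜 a) ^ r : Module.End 𝕜 𝓐) x)
        (((D : A →ₗ[𝕜] A) ^ r : Module.End 𝕜 A) z) := by
      intro r i x z hx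
      induction r with
      | zero => simpa using hx
      | succ r ih =>
        rw [pow_succ', pow_succ', show ((r + 1 : ℕ) : ℤ) * (e - d) + i =
          r * (e - d) + i + e - d by push_cast; ring]
        exact hΦcomm ih ha
    have hT : ∀ j {i x z}, Φ i x z → Φ (shift j + i) (T j x) (t j z) := by
      intro j i x z hx
      rw [add_assoc]
      exact hΦmul (hb' j) (hpow _ hx)
    have hlist : ∀ l : List (Fin (2 * n)),
        Φ (l.map shift).sum ((l.map T).prod 1) ((l.map t).prod 1) := by
      intro l
      induction l with
      | nil => simpa using hΦone
      | cons j l ih =>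
        simp only [List.map_cons, List.sum_cons, List.prod_cons]
        exact hT j ih
    refine hmemJ (i := ∑ i, shift i) (x := standardPolynomial (2 * n) T 1) ?_
      (standardPolynomial_mulLeft_mul_ad_pow_apply_mem 𝓘 _
        (fun v => TwoSidedIdeal.subset_span ⟨v, rfl⟩) a b' _ 1)
    simp only [standardPolynomial, LinearMap.sum_apply, LinearMap.smul_apply,
      LinearMap.applyₗ_apply_apply]
    refine hΦsum _ fun σ => hΦsmul _ ?_
    have := hlist (List.ofFn σ)
    rw [List.map_ofFn, List.map_ofFn, List.map_ofFn, List.sum_ofFn] at this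
    rw [← Equiv.sum_comp σ shift]
    exact this
  · intro i
    suffices h : Submodule.span 𝕜 H ≤ (Submodule.span 𝕜 (G i)).comap
        ((LinearMap.mulRight 𝕜 ((D : A →ₗ[𝕜] A) ^ (2 * n - 1 - i : ℕ) : Module.End 𝕜 A)).comp
          (LinearMap.mul 𝕜 A)) from h (hspan (f i))
    exact Submodule.span_le.2 fun g hg => Submodule.subset_span ⟨g, hg, rfl⟩
end

section
/- Let 𝕂 be a field of characteristic 0 and let A₁(𝕂) = 𝕂⟨u,v⟩/(uv − vu − 1) be the Weyl algebra, i.e. the quotient of the free associative unital 𝕂-algebra on two generators u, v by the two-sided ideal generated by uv − vu − 1. Then for every positive integer n the Weyl algebra does not satisfy the standard identity s_{2n}: there exist elements x₁,…,x_{2n} ∈ A₁(𝕂) with s_{2n}(x₁,…,x_{2n}) ≠ 0. -/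
open scoped BigOperators

/-- The defining relation of the Weyl algebra `A₁(𝕜) = 𝕜⟨u,v⟩/(uv - vu - 1)`:
we impose `uv = vu + 1` on the free associative unital algebra on two generators. -/
inductive WeylRel (𝕜 : Type*) [Field 𝕜] :
    FreeAlgebra 𝕜 (Fin 2) → FreeAlgebra 𝕜 (Fin 2) → Prop
  | rel : WeylRel 𝕜 (FreeAlgebra.ι 𝕜 0 * FreeAlgebra.ι 𝕜 1)
      (FreeAlgebra.ι 𝕜 1 * FreeAlgebra.ι 𝕜 0 + 1)

open Polynomial in
/-- The action of the Weyl algebra on `𝕜[X]`, with `u` acting as the derivative and `v` as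
multiplication by `X`. -/
noncomputable def weylAction (𝕜 : Type*) [Field 𝕜] :
    RingQuot (WeylRel 𝕜) →ₐ[𝕜] Module.End 𝕜 𝕜[X] :=
  RingQuot.liftAlgHom 𝕜
    ⟨FreeAlgebra.lift 𝕜 ![derivative, LinearMap.mulLeft 𝕜 X], by
      rintro _ _ ⟨⟩
      refine LinearMap.ext fun p => ?_
      simp [derivative_mul, add_comm]⟩

open Polynomial in
/-- For `j < N`, this element of the Weyl algebra acts on `𝕜[X]` in degrees below `N` by sending
`X ^ j` to `X ^ (j + 1)` and every other monomial to `0`. -/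
noncomputable def weylShift (𝕜 : Type*) [Field 𝕜] (N j : ℕ) : RingQuot (WeylRel 𝕜) :=
  let u := RingQuot.mkAlgHom 𝕜 (WeylRel 𝕜) (FreeAlgebra.ι 𝕜 0)
  let v := RingQuot.mkAlgHom 𝕜 (WeylRel 𝕜) (FreeAlgebra.ι 𝕜 1)
  v * aeval (v * u) (Lagrange.basis (Finset.range N) (fun k : ℕ => (k : 𝕜)) j)

open Polynomial in
theorem weylAction_weylShift_X_pow (𝕜 : Type*) [Field 𝕜] [CharZero 𝕜] {N j k : ℕ}
    (hj : j < N) (hk : k < N) :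
    weylAction 𝕜 (weylShift 𝕜 N j) (X ^ k) = if j = k then X ^ (k + 1) else 0 := by
  have hev : Module.End.HasEigenvector
      (LinearMap.mulLeft 𝕜 (X : 𝕜[X]) * derivative) (k : 𝕜) (X ^ k) := by
    refine ⟨Module.End.mem_eigenspace_iff.2 ?_, pow_ne_zero _ X_ne_zero⟩
    rcases k with _ | k
    · simp
    · simp [smul_eq_C_mul]
      ring
  have hbasis : (Lagrange.basis (Finset.range N) (fun k : ℕ => (k : 𝕜)) j).eval (k : 𝕜) =
      if j = k then 1 else 0 := by
    split_ifs with h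
    · subst h
      exact Lagrange.eval_basis_self Nat.cast_injective.injOn (Finset.mem_range.2 hj)
    · exact Lagrange.eval_basis_of_ne h (Finset.mem_range.2 hk)
  have hact : weylAction 𝕜 (weylShift 𝕜 N j) = LinearMap.mulLeft 𝕜 (X : 𝕜[X]) *
      aeval (LinearMap.mulLeft 𝕜 (X : 𝕜[X]) * derivative)
        (Lagrange.basis (Finset.range N) (fun k : ℕ => (k : 𝕜)) j) := by
    simp [weylAction, weylShift, ← aeval_algHom_apply]
  rw [hact, Module.End.mul_apply, Module.End.aeval_apply_of_hasEigenvector hev, hbasis]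
  split_ifs <;> simp [pow_succ']

/-- A product of elementary shifts `e j ↦ e (j + 1)` kills `e 0` unless the shifts are composed
in their natural order. -/
theorem prod_map_shift_apply_zero {R M : Type*} [Semiring R] [AddCommMonoid M] [Module R M]
    {N : ℕ} (T : Fin N → Module.End R M) (e : ℕ → M)
    (hT : ∀ j : Fin N, ∀ k < N, T j (e k) = if (j : ℕ) = k then e (k + 1) else 0)
    (l : List (Fin N)) (hl : l.length ≤ N) :
    (l.map T).prod (e 0) =
      if l.map Fin.val = (List.range l.length).reverse then e l.length else 0 := by
  induction l with
  | nil => simp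
  | cons a l ih =>
    rw [List.length_cons] at hl
    rw [List.map_cons, List.prod_cons, Module.End.mul_apply, ih (by omega)]
    by_cases h : l.map Fin.val = (List.range l.length).reverse
    · simp [h, hT a l.length (by omega), List.range_succ]
    · simp [h, List.range_succ]

theorem List.map_val_ofFn_perm_eq_reverse_range_iff {N : ℕ} (σ : Equiv.Perm (Fin N)) :
    (List.ofFn σ).map Fin.val = (List.range N).reverse ↔ σ = Fin.revPerm := by
  constructor
  · intro h
    ext i
    have := congrArg (fun l => l[(i : ℕ)]?) h
    simp at this
    simp [Fin.val_rev]
    omega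
  · rintro rfl
    refine List.ext_getElem (by simp) fun i _ _ => ?_
    simp [Fin.val_rev]
    omega

/-- The Weyl algebra over a field of characteristic `0` does not satisfy the standard
identity `s_{2n}` for any positive integer `n`. -/
theorem weylAlgebra_not_satisfies_standard_identity
    (𝕜 : Type*) [Field 𝕜] [CharZero 𝕜] (n : ℕ) (hn : 0 < n) :
    ∃ x : Fin (2 * n) → RingQuot (WeylRel 𝕜),
      standardPolynomial (2 * n) x ≠ 0 := by
  refine ⟨fun j => weylShift 𝕜 (2 * n) j, fun h => ?_⟩
  have hprod (σ : Equiv.Perm (Fin (2 * n))) :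
      weylAction 𝕜 (List.ofFn fun i => weylShift 𝕜 (2 * n) (σ i)).prod (Polynomial.X ^ 0) =
        if σ = Fin.revPerm then Polynomial.X ^ (2 * n) else 0 := by
    have := prod_map_shift_apply_zero (fun j : Fin (2 * n) => weylAction 𝕜 (weylShift 𝕜 (2 * n) j))
      (fun k => Polynomial.X ^ k) (fun j k hk => weylAction_weylShift_X_pow 𝕜 j.2 hk) (List.ofFn σ) (by simp)
    simp only [List.length_ofFn, List.map_val_ofFn_perm_eq_reverse_range_iff] at this
    rw [← this, map_list_prod, List.map_ofFn, List.map_ofFn]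
    rfl
  have hsum := congrArg (fun a => weylAction 𝕜 a (Polynomial.X ^ 0)) h
  simp only [standardPolynomial, map_sum, map_zsmul, LinearMap.sum_apply, LinearMap.smul_apply,
    hprod, map_zero, LinearMap.zero_apply, smul_ite, smul_zero, Finset.sum_ite_eq',
    Finset.mem_univ, if_true] at hsum
  rcases Int.units_eq_one_or (Equiv.Perm.sign (Fin.revPerm : Equiv.Perm (Fin (2 * n)))) with hs | hs
    <;> simp [hs] at hsum
end

section
/- Let 𝕂 be a field of characteristic 0 and let R be a nonzero associative unital algebra over the formal power series ring 𝕂[[ħ]] which is flat (equivalently, torsion-free) as a 𝕂[[ħ]]-module. Suppose there exist elements a, b ∈ R and an integer d ≥ 1 with ab − ba = ħ^d·1. Then for every positive integer n the algebra R does not satisfy the standard identity s_{2n}: there exist x₁,…,x_{2n} ∈ R with s_{2n}(x₁,…,x_{2n}) ≠ 0. -/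
open scoped BigOperators

open Polynomial in
/-- If `b * y = (y - t) * b` with `t` a scalar, then a product of factors `y ^ e k * b` can be
rewritten with all the powers of `b` on the right. -/
theorem prod_ofFn_pow_mul_eq {S R : Type*} [CommRing S] [Ring R] [Algebra S R] {b y : R} {t : S}
    (hby : b * y = (y - algebraMap S R t) * b) (m : ℕ) (e : Fin m → ℕ) :
    (List.ofFn fun k => y ^ e k * b).prod =
      aeval y (∏ k : Fin m, (X - C ((k : ℕ) * t)) ^ e k) * b ^ m := by
  have hpow (k : ℕ) : SemiconjBy (b ^ k) y (y - algebraMap S R (k * t)) := by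
    induction k with
    | zero => simp
    | succ k ih =>
      have hcomm : SemiconjBy b (algebraMap S R (k * t)) (algebraMap S R (k * t)) :=
        (Algebra.commutes (k * t) b).symm
      have h := (SemiconjBy.sub_right hby hcomm).mul_left ih
      rw [pow_succ', show ((k + 1 : ℕ) : S) * t = t + k * t by push_cast; ring, map_add,
        ← sub_sub]
      exact h
  induction m with
  | zero => simp
  | succ m ih =>
    rw [List.ofFn_succ', List.concat_eq_append, List.prod_append, ih, Fin.prod_univ_castSucc]
    have h := ((hpow m).pow_right (e (Fin.last m))).eq
    simp only [Fin.val_castSucc, Fin.val_last, map_mul, map_pow, map_sub, aeval_X, aeval_C,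
      List.prod_singleton] at h ⊢
    rw [mul_assoc, ← mul_assoc (b ^ m), h, pow_succ]
    simp only [mul_assoc]

open Polynomial in
/-- The standard polynomial evaluated at `b, y * b, …, y ^ (m - 1) * b`, where
`b * y = (y - t) * b`, is given by a Vandermonde determinant. -/
theorem standardPolynomial_pow_mul_eq {S R : Type*} [CommRing S] [Ring R] [Algebra S R] {b y : R}
    {t : S} (hby : b * y = (y - algebraMap S R t) * b) (m : ℕ) :
    standardPolynomial m (fun i => y ^ (i : ℕ) * b) =
      (∏ i : Fin m, ∏ j ∈ Finset.Ioi i, (((i : ℕ) : S) - (j : ℕ)) * t) • b ^ m := by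
  have hdet : (Matrix.vandermonde fun k : Fin m => (X - C ((k : ℕ) * t) : S[X])).det =
      C (∏ i : Fin m, ∏ j ∈ Finset.Ioi i, (((i : ℕ) : S) - (j : ℕ)) * t) := by
    simp only [Matrix.det_vandermonde, map_prod]
    refine Finset.prod_congr rfl fun i _ => Finset.prod_congr rfl fun j _ => ?_
    rw [sub_sub_sub_cancel_left, ← C_sub, sub_mul]
  rw [Algebra.smul_def, ← aeval_C y, ← hdet, ← Matrix.det_transpose, Matrix.det_apply, map_sum,
    Finset.sum_mul, standardPolynomial]
  refine Finset.sum_congr rfl fun σ _ => ?_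
  rw [prod_ofFn_pow_mul_eq hby, Units.smul_def, map_zsmul, smul_mul_assoc]
  rfl

/-- If the commutator of `a` and `b` is a nonzero scalar, then `b` is not nilpotent. -/
theorem pow_ne_zero_of_commutator_eq_algebraMap {S R : Type*} [CommRing S] [IsDomain S]
    [CharZero S] [Ring R] [Nontrivial R] [Algebra S R] [Module.IsTorsionFree S R] {a b : R} {t : S}
    (ht : t ≠ 0) (hab : a * b - b * a = algebraMap S R t) (m : ℕ) : b ^ m ≠ 0 := by
  have hcomm (k : ℕ) : a * b ^ (k + 1) - b ^ (k + 1) * a = (((k + 1 : ℕ) : S) * t) • b ^ k := by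
    induction k with
    | zero => simpa [Algebra.smul_def] using hab
    | succ k ih =>
      have hsplit : a * b ^ (k + 2) - b ^ (k + 2) * a =
          (a * b ^ (k + 1) - b ^ (k + 1) * a) * b + b ^ (k + 1) * (a * b - b * a) := by
        rw [pow_succ b (k + 1)]
        noncomm_ring
      rw [hsplit, ih, hab, ← Algebra.commutes, ← Algebra.smul_def, smul_mul_assoc, ← pow_succ,
        ← add_smul]
      congr 1
      push_cast
      ring
  induction m with
  | zero => simp
  | succ m ih =>
    intro h
    have h0 := hcomm m
    rw [h, mul_zero, zero_mul, sub_zero] at h0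
    exact smul_ne_zero (mul_ne_zero (Nat.cast_ne_zero.mpr m.succ_ne_zero) ht) ih h0.symm

/-- Let `𝕜` be a field of characteristic `0` and `R` a nonzero associative unital algebra over
the power series ring `𝕜[[ħ]]` which is flat as a `𝕜[[ħ]]`-module.  If there are `a b : R` and
`d ≥ 1` with `a*b - b*a = ħ^d · 1`, then `R` does not satisfy the standard identity `s_{2n}`
for any positive integer `n`. -/
theorem not_satisfies_standard_identity_of_flat_of_commutator_eq_hbar_pow
    (𝕜 : Type*) [Field 𝕜] [CharZero 𝕜]
    (R : Type*) [Ring R] [Nontrivial R] [Algebra (PowerSeries 𝕜) R]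
    [Module.Flat (PowerSeries 𝕜) R]
    (a b : R) (d : ℕ) (hd : 1 ≤ d)
    (hab : a * b - b * a = algebraMap (PowerSeries 𝕜) R ((PowerSeries.X : PowerSeries 𝕜) ^ d))
    (n : ℕ) (hn : 0 < n) :
    ∃ x : Fin (2 * n) → R, standardPolynomial (2 * n) x ≠ 0 := by
  have : CharZero (PowerSeries 𝕜) := algebraRat.charZero _
  have ht : (PowerSeries.X : PowerSeries 𝕜) ^ d ≠ 0 := pow_ne_zero d PowerSeries.X_ne_zero
  have hby : b * (b * a) =
      (b * a - algebraMap (PowerSeries 𝕜) R ((PowerSeries.X : PowerSeries 𝕜) ^ d)) * b := by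
    rw [sub_mul, Algebra.commutes, ← hab]
    noncomm_ring
  refine ⟨fun i => (b * a) ^ (i : ℕ) * b, ?_⟩
  rw [standardPolynomial_pow_mul_eq hby]
  refine smul_ne_zero (Finset.prod_ne_zero_iff.mpr fun i _ => Finset.prod_ne_zero_iff.mpr
    fun j hj => mul_ne_zero ?_ ht) (pow_ne_zero_of_commutator_eq_algebraMap ht hab _)
  rw [sub_ne_zero, Nat.cast_injective.ne_iff]
  exact (Fin.lt_def.mp (Finset.mem_Ioi.mp hj)).ne
end

section
/- Let 𝔤 be a finite-dimensional semisimple Lie algebra over an algebraically closed field of characteristic 0, 𝔥 a Cartan subalgebra, and Δ ⊆ 𝔥* the set of roots, with root space decomposition 𝔤 = 𝔥 ⊕ ⊕_{α∈Δ} 𝔤_α. Let 𝔱 ⊆ 𝔥 be a subspace and let (e, h, f) be an sl₂-triple in 𝔤 (so [h,e] = 2e, [h,f] = −2f, [e,f] = h) such that e, h, f all centralize 𝔱 and h ∈ 𝔥. Then for every linear functional μ on 𝔱 and every integer l, the number of roots α ∈ Δ with α|_𝔱 = μ and α(h) = l equals the number of roots α ∈ Δ with α|_𝔱 = μ and α(h)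 = −l. -/
open LieModule

namespace LieAlgebra

variable {K L : Type*} [Field K] [CharZero K] [LieRing L] [LieAlgebra K L]

/-- In characteristic zero, a member of a finite-dimensional Lie algebra which is an eigenvector for
the adjoint action of some element, with nonzero eigenvalue, is ad-nilpotent. -/
lemma isNilpotent_ad_of_lie_eq_smul [FiniteDimensional K L] {h x : L} {c : K} (hc : c ≠ 0)
    (hx : ⁅h, x⁆ = c • x) : IsNilpotent (ad K L x) := by
  by_contra contra
  have hne (n : ℕ) : ad K L x ^ n ≠ 0 := fun hn ↦ contra ⟨n, hn⟩
  have hcomm : ad K L h * ad K L x - ad K L x * ad K L h = c • ad K L x := by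
    ext z
    simp [← lie_lie, hx]
  let D : Module.End K (Module.End K L) :=
    LinearMap.mulLeft K (ad K L h) - LinearMap.mulRight K (ad K L h)
  have hD (n : ℕ) : D (ad K L x ^ n) = ((n : K) * c) • ad K L x ^ n := by
    induction n with
    | zero => simp [D]
    | succ n ih =>
      simp only [D, LinearMap.sub_apply, LinearMap.mulLeft_apply, LinearMap.mulRight_apply] at ih ⊢
      calc ad K L h * ad K L x ^ (n + 1) - ad K L x ^ (n + 1) * ad K L h
          = (ad K L h * ad K L x ^ n - ad K L x ^ n * ad K L h) * ad K L x +
            ad K L x ^ n * (ad K L h * ad K L x - ad K L x * ad K L h) := by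
              rw [pow_succ]; noncomm_ring
        _ = _ := by
              rw [ih, hcomm, smul_mul_assoc, mul_smul_comm, ← pow_succ, ← add_smul]
              push_cast
              ring_nf
  have hinj : Function.Injective fun n : ℕ ↦ (n : K) * c := fun m n hmn ↦ by
    simpa [hc] using hmn
  have hli := D.eigenvectors_linearIndependent' _ hinj _
    fun n ↦ Module.End.hasEigenvector_iff.mpr ⟨Module.End.mem_eigenspace_iff.mpr (hD n), hne n⟩
  exact not_finite_iff_infinite.mpr inferInstance hli.finite

/-- The Lie algebra automorphism `exp (ad e) ∘ exp (-ad f) ∘ exp (ad e)` associated to an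
`sl₂`-triple `(e, h, f)` negates `h` and fixes the centralizer of the triple. -/
lemma exists_lieEquiv_apply_eq_neg_of_sl2 [FiniteDimensional K L] {e h f : L}
    (hhe : ⁅h, e⁆ = (2 : K) • e) (hhf : ⁅h, f⁆ = (-2 : K) • f) (hef : ⁅e, f⁆ = h) :
    ∃ θ : L ≃ₗ⁅K⁆ L, θ h = -h ∧ ∀ x, ⁅e, x⁆ = 0 → ⁅f, x⁆ = 0 → θ x = x := by
  let _ : Module ℚ L := Module.compHom L (algebraMap ℚ K)
  let _ : LieAlgebra ℚ L := { lie_smul := fun q x y ↦ lie_smul (algebraMap ℚ K q) x y }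
  have : IsScalarTower ℚ K L := ⟨fun q a x ↦ by
    rw [Algebra.smul_def, mul_smul]; rfl⟩
  have hne : IsNilpotent (LieDerivation.ad K L e).toLinearMap := by
    have := isNilpotent_ad_of_lie_eq_smul two_ne_zero hhe
    rwa [← LieDerivation.coe_ad_apply_eq_ad_apply] at this
  have hnf : IsNilpotent (LieDerivation.ad K L (-f)).toLinearMap := by
    have := isNilpotent_ad_of_lie_eq_smul (K := K) (x := -f) (h := h) (c := -2) (by simp)
      (by rw [lie_neg, hhf, smul_neg])
    rwa [← LieDerivation.coe_ad_apply_eq_ad_apply] at this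
  have exp_eq {y : L} (hn : IsNilpotent (LieDerivation.ad K L y).toLinearMap) (x : L)
      (h0 : ⁅y, ⁅y, ⁅y, x⁆⁆⁆ = 0) :
      LieDerivation.exp _ hn x = x + ⁅y, x⁆ + (2 : K)⁻¹ • ⁅y, ⁅y, x⁆⁆ := by
    have := IsNilpotent.exp_smul_eq_sum (m := x) (k := 3)
      (a := (LieDerivation.ad K L y).toLinearMap) (by simpa [pow_succ] using h0) hn
    rw [LieDerivation.exp_map_apply, ← Module.End.smul_def, this]
    have h2 : (2 : ℚ)⁻¹ • ⁅y, ⁅y, x⁆⁆ = (2 : K)⁻¹ • ⁅y, ⁅y, x⁆⁆ := by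
      rw [← algebraMap_smul K (2 : ℚ)⁻¹]; simp
    simp [Finset.sum_range_succ, pow_succ, h2, Nat.factorial]
  have heh : ⁅e, h⁆ = (-2 : K) • e := by rw [← lie_skew, hhe, neg_smul]
  have hfh : ⁅f, h⁆ = (2 : K) • f := by rw [← lie_skew, hhf, neg_smul, neg_neg]
  have hfe : ⁅f, e⁆ = -h := by rw [← lie_skew, hef]
  let E := LieDerivation.exp _ hne
  let F := LieDerivation.exp _ hnf
  have hE : E h = h - (2 : K) • e := by
    rw [exp_eq hne h (by simp [heh])]
    simp only [heh, lie_smul, lie_self]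
    module
  have hF : F (h - (2 : K) • e) = -h - (2 : K) • e := by
    rw [exp_eq hnf _ (by simp [hfh, hfe])]
    simp only [hfh, hfe, lie_smul, lie_self, lie_sub, neg_lie, lie_neg, smul_neg]
    module
  have hE' : E (-h - (2 : K) • e) = -h := by
    rw [exp_eq hne _ (by simp [heh])]
    simp only [heh, lie_smul, lie_self, lie_sub, lie_neg, smul_zero, lie_zero]
    module
  refine ⟨(E.trans F).trans E, ?_, fun x hex hfx ↦ ?_⟩
  · simp only [LieEquiv.trans_apply, hE, hF, hE']
  · have hEx : E x = x := by rw [exp_eq hne x (by simp [hex])]; simp [hex]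
    have hFx : F x = x := by rw [exp_eq hnf x (by simp [hfx])]; simp [hfx]
    simp only [LieEquiv.trans_apply, hEx, hFx]

/-- A simultaneous eigenspace of members of a splitting Cartan subalgebra, one of whose eigenvalues
is nonzero, has dimension equal to the number of roots taking the prescribed values. -/
lemma finrank_iInf_eigenspace_ad_eq_ncard [FiniteDimensional K L] [IsKilling K L]
    (H : LieSubalgebra K L) [H.IsCartanSubalgebra] [IsTriangularizable K H L]
    {ι : Type*} (y : ι → H) (c : ι → K) {i₀ : ι} (hc : c i₀ ≠ 0) :
    Module.finrank K (⨅ i, (ad K L (y i : L)).eigenspace (c i) : Submodule K L) =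
      {α : Weight K H L | ∀ i, α (y i) = c i}.ncard := by
  set S := {α : Weight K H L | ∀ i, α (y i) = c i}
  have hS (α : S) : (α : Weight K H L).IsNonZero := fun h0 ↦
    hc <| by rw [← α.2 i₀, h0.eq, Pi.zero_apply]
  choose v hv hv0 using fun α : Weight K H L ↦ α.exists_ne_zero
  let N : LieSubmodule K H L :=
    { (⨅ i, (ad K L (y i : L)).eigenspace (c i) : Submodule K L) with
      lie_mem := fun {z x} hx ↦ by
        have hx' : x ∈ (⨅ i, (ad K L (y i : L)).eigenspace (c i) : Submodule K L) := hx
        change ⁅z, x⁆ ∈ (⨅ i, (ad K L (y i : L)).eigenspace (c i) : Submodule K L)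
        simp only [Submodule.mem_iInf, Module.End.mem_eigenspace_iff, ad_apply] at hx' ⊢
        intro i
        change ⁅y i, ⁅z, x⁆⁆ = _
        rw [leibniz_lie, trivial_lie_zero H H, zero_lie, zero_add]
        change ⁅z, ⁅(y i : L), x⁆⁆ = _
        rw [hx' i, lie_smul] }
  have hN {x : L} : x ∈ N ↔ ∀ i, ⁅y i, x⁆ = c i • x := by
    change x ∈ (⨅ i, (ad K L (y i : L)).eigenspace (c i) : Submodule K L) ↔ _
    simp only [Submodule.mem_iInf, Module.End.mem_eigenspace_iff, ad_apply]
    rfl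
  have hspan : N.toSubmodule = Submodule.span K (Set.range fun α : S ↦ v α) := by
    apply le_antisymm
    · rw [eq_iSup_inf_genWeightSpace K H L N, LieSubmodule.iSup_toSubmodule]
      refine iSup_le fun α x hx ↦ ?_
      obtain ⟨hxN, hxα⟩ : x ∈ N ∧ x ∈ rootSpace H α := by simpa using hx
      obtain rfl | hx0 := eq_or_ne x 0
      · exact zero_mem _
      have hα : α ∈ S := fun i ↦ smul_left_injective K hx0 <| by
        simpa only [IsKilling.lie_eq_smul_of_mem_rootSpace hxα] using hN.mp hxN i
      have h1 := IsKilling.finrank_rootSpace_eq_one α (hS ⟨α, hα⟩)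
      obtain ⟨a, ha⟩ := (finrank_eq_one_iff_of_nonzero' (⟨v α, hv α⟩ : rootSpace H α)
        (by simpa using hv0 α)).mp h1 ⟨x, hxα⟩
      have ha' : a • v α = x := congrArg Subtype.val ha
      rw [← ha']
      exact Submodule.smul_mem _ _ (Submodule.subset_span ⟨⟨α, hα⟩, rfl⟩)
    · rw [Submodule.span_le]
      rintro _ ⟨α, rfl⟩
      refine hN.mpr fun i ↦ ?_
      rw [IsKilling.lie_eq_smul_of_mem_rootSpace (hv α), α.2 i]
  have hli : LinearIndependent K fun α : Weight K H L ↦ v α :=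
    (LieSubmodule.iSupIndep_toSubmodule.mpr (iSupIndep_genWeightSpace' K H L)).linearIndependent
      _ hv hv0
  have := Fintype.ofFinite S
  change Module.finrank K N.toSubmodule = _
  have hli' : LinearIndependent K fun α : S ↦ v α := hli.comp _ Subtype.val_injective
  rw [hspan, finrank_span_eq_card hli', ← Nat.card_eq_fintype_card,
    Nat.card_coe_set_eq]

end LieAlgebra

/-- Let `𝔤` be a finite-dimensional semisimple Lie algebra over an algebraically closed field of
characteristic `0`, `𝔥` a Cartan subalgebra with set of roots `Δ` (the nonzero weights of the
adjoint representation), `𝔱 ⊆ 𝔥` a subspace and `(e, h, f)` an `sl₂`-triple centralizing `𝔱`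
with `h ∈ 𝔥`.  Then for every linear functional `μ` on `𝔱` and every integer `l`, the number of
roots `α` with `α|_𝔱 = μ` and `α(h) = l` equals the number of roots `α` with `α|_𝔱 = μ` and
`α(h) = -l`. -/
theorem card_roots_restriction_eq_of_sl2
    (𝕜 : Type*) [Field 𝕜] [IsAlgClosed 𝕜] [CharZero 𝕜]
    (L : Type*) [LieRing L] [LieAlgebra 𝕜 L] [FiniteDimensional 𝕜 L]
    [LieAlgebra.IsSemisimple 𝕜 L]
    (H : LieSubalgebra 𝕜 L) [H.IsCartanSubalgebra]
    (t : Submodule 𝕜 L) (ht : ∀ x ∈ t, x ∈ H)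
    (e h f : L)
    (hhe : ⁅h, e⁆ = (2 : 𝕜) • e) (hhf : ⁅h, f⁆ = (-2 : 𝕜) • f) (hef : ⁅e, f⁆ = h)
    (hcent : ∀ x ∈ t, ⁅e, x⁆ = 0 ∧ ⁅h, x⁆ = 0 ∧ ⁅f, x⁆ = 0)
    (hh : h ∈ H)
    (μ : t →ₗ[𝕜] 𝕜) (l : ℤ) :
    Set.ncard {α : Weight 𝕜 H L | α.IsNonZero ∧
        (∀ x (hx : x ∈ t), α ⟨x, ht x hx⟩ = μ ⟨x, hx⟩) ∧ α ⟨h, hh⟩ = (l : 𝕜)} =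
      Set.ncard {α : Weight 𝕜 H L | α.IsNonZero ∧
        (∀ x (hx : x ∈ t), α ⟨x, ht x hx⟩ = μ ⟨x, hx⟩) ∧ α ⟨h, hh⟩ = (-l : 𝕜)} := by
  obtain rfl | hl := eq_or_ne l 0
  · simp
  have hl' : (l : 𝕜) ≠ 0 := Int.cast_ne_zero.mpr hl
  let y : Option t → H := fun i ↦ i.elim ⟨h, hh⟩ fun x ↦ ⟨x, ht x x.2⟩
  let c (a : 𝕜) : Option t → 𝕜 := fun i ↦ i.elim a μ
  have key {a : 𝕜} (ha : a ≠ 0) :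
      Set.ncard {α : Weight 𝕜 H L | α.IsNonZero ∧
        (∀ x (hx : x ∈ t), α ⟨x, ht x hx⟩ = μ ⟨x, hx⟩) ∧ α ⟨h, hh⟩ = a} =
      Module.finrank 𝕜
        (⨅ i, (LieAlgebra.ad 𝕜 L (y i : L)).eigenspace (c a i) : Submodule 𝕜 L) := by
    rw [LieAlgebra.finrank_iInf_eigenspace_ad_eq_ncard H y (c a) (i₀ := none) ha]
    congr 1
    ext α
    simp only [Set.mem_ofPred_eq, Option.forall, Subtype.forall, y, c, Option.elim]
    refine ⟨fun ⟨_, h₁, h₂⟩ ↦ ⟨h₂, h₁⟩, fun ⟨h₂, h₁⟩ ↦ ⟨fun h₀ ↦ ha ?_, h₁, h₂⟩⟩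
    rw [← h₂, h₀.eq, Pi.zero_apply]
  obtain ⟨θ, hθh, hθ⟩ := LieAlgebra.exists_lieEquiv_apply_eq_neg_of_sl2 hhe hhf hef
  have hθt (x : L) (hx : x ∈ t) : θ x = x := hθ x (hcent x hx).1 (hcent x hx).2.2
  have hθinj {x x' : L} : θ x = θ x' ↔ x = x' := θ.injective.eq_iff
  rw [key hl', key (neg_ne_zero.mpr hl'), ← LinearEquiv.finrank_map_eq θ.toLinearEquiv]
  have hmem (a : 𝕜) (x : L) :
      x ∈ (⨅ i, (LieAlgebra.ad 𝕜 L (y i : L)).eigenspace (c a i) : Submodule 𝕜 L) ↔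
        ⁅h, x⁆ = a • x ∧ ∀ z (hz : z ∈ t), ⁅z, x⁆ = μ ⟨z, hz⟩ • x := by
    simp [Submodule.mem_iInf, Option.forall, y, c]
  have hmap (x : L) :
      x ∈ (⨅ i, (LieAlgebra.ad 𝕜 L (y i : L)).eigenspace (c l i) : Submodule 𝕜 L) ↔
        θ x ∈ (⨅ i, (LieAlgebra.ad 𝕜 L (y i : L)).eigenspace (c (-l) i) : Submodule 𝕜 L) := by
    rw [hmem, hmem]
    refine and_congr ?_ (forall₂_congr fun z hz ↦ ?_)
    · have : ⁅h, θ x⁆ = -θ ⁅h, x⁆ := by rw [LieEquiv.map_lie, hθh, neg_lie, neg_neg]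
      rw [this, neg_smul, neg_inj, ← map_smul, hθinj]
    · have : ⁅z, θ x⁆ = θ ⁅z, x⁆ := by rw [LieEquiv.map_lie, hθt z hz]
      rw [this, ← map_smul, hθinj]
  suffices Submodule.map (θ.toLinearEquiv : L →ₗ[𝕜] L)
      (⨅ i, (LieAlgebra.ad 𝕜 L (y i : L)).eigenspace (c l i)) =
      ⨅ i, (LieAlgebra.ad 𝕜 L (y i : L)).eigenspace (c (-l) i) by rw [this]
  ext x
  obtain ⟨x, rfl⟩ := θ.surjective x
  refine Iff.trans ?_ (hmap x)
  exact θ.toLinearEquiv.injective.mem_set_image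
end

section
/- Let 𝕂 be an algebraically closed field of characteristic 0, H a group, and V₁, V₂ finite-dimensional 𝕂-linear representations of H that are semisimple as H-modules, each equipped with an H-invariant symplectic form ω₁ on V₁ and ω₂ on V₂ (i.e. nondegenerate alternating bilinear forms with ωᵢ(g·u, g·v) = ωᵢ(u,v) for all g ∈ H). If V₁ and V₂ are isomorphic as H-representations, then there exists an H-equivariant linear isomorphism φ : V₁ → V₂ with ω₂(φ(u), φ(v)) = ω₁(u, v) for all u, v ∈ V₁; that is, equivariantly isomorphic symplectic H-modules are equivariantly symplectomorphic. -/
open Polynomial in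
/-- Over an algebraically closed field of characteristic zero, `X` is a square modulo every monic
polynomial that does not vanish at `0`. -/
theorem Polynomial.exists_dvd_sq_sub_X {K : Type*} [Field K] [IsAlgClosed K] [CharZero K]
    {p : K[X]} (hp : p.Monic) (h0 : ¬ p.IsRoot 0) : ∃ q : K[X], p ∣ q ^ 2 - X := by
  classical
  choose s hs using fun a : K => IsAlgClosed.exists_pow_nat_eq a (n := 2) two_pos
  set q₀ : K[X] := Lagrange.interpolate p.roots.toFinset id s with hq₀
  have hdvd : p ∣ (q₀ ^ 2 - X) ^ p.roots.card := by
    conv_lhs => rw [(IsAlgClosed.splits p).eq_prod_roots_of_monic hp]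
    rw [← Multiset.prod_replicate, ← Multiset.map_const']
    refine Multiset.prod_dvd_prod_of_dvd _ _ fun a ha => dvd_iff_isRoot.mpr ?_
    have : q₀.eval a = s a :=
      Lagrange.eval_interpolate_at_node (v := id) s (Set.injOn_id _) (Multiset.mem_toFinset.mpr ha)
    simp [this, hs]
  have hX : IsUnit (AdjoinRoot.root p) := by
    obtain ⟨u, v, huv⟩ : IsCoprime X p :=
      (irreducible_X.coprime_iff_not_dvd).mpr fun h => h0 (dvd_iff_isRoot.mp (by simpa using h))
    refine IsUnit.of_mul_eq_one (AdjoinRoot.mk p u) ?_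
    have := congrArg (AdjoinRoot.mk p) huv
    simpa [mul_comm] using this
  have hnil : IsNilpotent (AdjoinRoot.mk p q₀ ^ 2 - AdjoinRoot.root p) :=
    ⟨p.roots.card, by simpa using AdjoinRoot.mk_eq_zero.mpr hdvd⟩
  have hunit : IsUnit (AdjoinRoot.mk p q₀) := by
    have := hnil.isUnit_add_left_of_commute hX (Commute.all _ _)
    rw [add_sub_cancel] at this
    exact (isUnit_pow_iff two_ne_zero).mp this
  have htwo : IsUnit (2 : AdjoinRoot p) := by
    have := (IsUnit.mk0 (2 : K) two_ne_zero).map (algebraMap K (AdjoinRoot p))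
    rwa [map_ofNat] at this
  obtain ⟨r, ⟨-, hr⟩, -⟩ := existsUnique_nilpotent_sub_and_aeval_eq_zero
    (P := (X ^ 2 - C (AdjoinRoot.root p) : (AdjoinRoot p)[X])) (x := AdjoinRoot.mk p q₀)
    (by simpa using hnil) (by simpa [one_add_one_eq_two] using htwo.mul hunit)
  obtain ⟨q, rfl⟩ := AdjoinRoot.mk_surjective r
  exact ⟨q, AdjoinRoot.mk_eq_zero.mp (by simpa using hr)⟩

open Polynomial in
/-- An injective endomorphism of a finite-dimensional space over an algebraically closed field of
characteristic zero has a square root that is a polynomial in it. -/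
theorem Module.End.exists_aeval_sq_eq {K V : Type*} [Field K] [IsAlgClosed K] [CharZero K]
    [AddCommGroup V] [Module K V] [FiniteDimensional K V] (T : Module.End K V)
    (hT : Function.Injective T) : ∃ q : K[X], aeval T q ^ 2 = T := by
  have h0 : ¬ (minpoly K T).IsRoot 0 := by
    rw [← Module.End.hasEigenvalue_iff_isRoot]
    intro h
    obtain ⟨v, hv⟩ := h.exists_hasEigenvector
    refine hv.2 (hT ?_)
    simpa using hv.apply_eq_smul
  obtain ⟨q, r, hr⟩ :=
    Polynomial.exists_dvd_sq_sub_X (minpoly.monic (Algebra.IsIntegral.isIntegral T)) h0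
  refine ⟨q, sub_eq_zero.mp ?_⟩
  simpa using congrArg (aeval T) hr

open Polynomial in
/-- Polynomials in an endomorphism that is self-adjoint for a bilinear form are self-adjoint. -/
theorem LinearMap.IsAdjointPair.aeval_self {K V : Type*} [Field K] [AddCommGroup V] [Module K V]
    {B : V →ₗ[K] V →ₗ[K] K} {T : Module.End K V} (h : LinearMap.IsAdjointPair B B T T)
    (q : K[X]) : LinearMap.IsAdjointPair B B (aeval T q) (aeval T q) := by
  induction q using Polynomial.induction_on' with
  | add p q hp hq => intro u v; simp [hp u v, hq u v]
  | monomial n a =>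
    have hn : ∀ u v, B ((T ^ n) u) v = B u ((T ^ n) v) := by
      induction n with
      | zero => simp
      | succ n ih =>
        intro u v
        rw [pow_succ, Module.End.mul_apply, ih, h, ← Module.End.mul_apply, ← pow_succ', pow_succ]
    intro u v
    simp [aeval_monomial, Module.algebraMap_end_apply, hn u v]


/-- Over an algebraically closed field of characteristic `0`, two finite-dimensional semisimple
representations of a group `H`, each carrying an `H`-invariant symplectic (nondegenerate
alternating bilinear) form, which are isomorphic as `H`-representations, are `H`-equivariantly
symplectomorphic: there is an `H`-equivariant linear isomorphism intertwining the two forms. -/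
theorem equivariant_symplectomorphism_of_equivariant_iso
    (𝕜 : Type*) [Field 𝕜] [IsAlgClosed 𝕜] [CharZero 𝕜]
    (H : Type*) [Group H]
    (V₁ V₂ : Type*)
    [AddCommGroup V₁] [Module 𝕜 V₁] [FiniteDimensional 𝕜 V₁]
    [AddCommGroup V₂] [Module 𝕜 V₂] [FiniteDimensional 𝕜 V₂]
    (ρ₁ : Representation 𝕜 H V₁) (ρ₂ : Representation 𝕜 H V₂)
    -- `V₁` is semisimple as an `H`-module: every `H`-invariant subspace has an
    -- `H`-invariant complement
    (hss₁ : ∀ W : Submodule 𝕜 V₁, (∀ (g : H), ∀ v ∈ W, ρ₁ g v ∈ W) →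
      ∃ W' : Submodule 𝕜 V₁, (∀ (g : H), ∀ v ∈ W', ρ₁ g v ∈ W') ∧ IsCompl W W')
    (hss₂ : ∀ W : Submodule 𝕜 V₂, (∀ (g : H), ∀ v ∈ W, ρ₂ g v ∈ W) →
      ∃ W' : Submodule 𝕜 V₂, (∀ (g : H), ∀ v ∈ W', ρ₂ g v ∈ W') ∧ IsCompl W W')
    -- the symplectic forms
    (ω₁ : V₁ →ₗ[𝕜] V₁ →ₗ[𝕜] 𝕜) (ω₂ : V₂ →ₗ[𝕜] V₂ →ₗ[𝕜] 𝕜)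
    (halt₁ : ∀ v : V₁, ω₁ v v = 0) (halt₂ : ∀ v : V₂, ω₂ v v = 0)
    (hnd₁ : ∀ u : V₁, (∀ v : V₁, ω₁ u v = 0) → u = 0)
    (hnd₂ : ∀ u : V₂, (∀ v : V₂, ω₂ u v = 0) → u = 0)
    -- `H`-invariance of the forms
    (hinv₁ : ∀ (g : H) (u v : V₁), ω₁ (ρ₁ g u) (ρ₁ g v) = ω₁ u v)
    (hinv₂ : ∀ (g : H) (u v : V₂), ω₂ (ρ₂ g u) (ρ₂ g v) = ω₂ u v)
    -- `V₁ ≅ V₂` as `H`-representations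
    (hiso : ∃ e : V₁ ≃ₗ[𝕜] V₂, ∀ (g : H) (v : V₁), e (ρ₁ g v) = ρ₂ g (e v)) :
    ∃ φ : V₁ ≃ₗ[𝕜] V₂, (∀ (g : H) (v : V₁), φ (ρ₁ g v) = ρ₂ g (φ v)) ∧
      ∀ u v : V₁, ω₂ (φ u) (φ v) = ω₁ u v := by
  obtain ⟨e, he⟩ := hiso
  have hinj : Function.Injective ω₁ := (injective_iff_map_eq_zero ω₁).mpr fun u hu =>
    hnd₁ u fun v => by simp [hu]
  let D : V₁ ≃ₗ[𝕜] Module.Dual 𝕜 V₁ :=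
    LinearEquiv.ofInjectiveOfFinrankEq ω₁ hinj Subspace.dual_finrank_eq.symm
  let T : Module.End 𝕜 V₁ := D.symm.toLinearMap ∘ₗ ω₂.compl₁₂ e.toLinearMap e.toLinearMap
  have hT : ∀ u v, ω₁ (T u) v = ω₂ (e u) (e v) := fun u v =>
    congrArg (fun f : Module.Dual 𝕜 V₁ => f v)
      (D.apply_symm_apply (ω₂.compl₁₂ e.toLinearMap e.toLinearMap u))
  have hTinj : Function.Injective T := (injective_iff_map_eq_zero T).mpr fun u hu => by
    refine e.map_eq_zero_iff.mp (hnd₂ _ fun v => ?_)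
    rw [← e.apply_symm_apply v, ← hT, hu, map_zero, LinearMap.zero_apply]
  have hTadj : LinearMap.IsAdjointPair ω₁ ω₁ T T := fun u v => by
    rw [hT, ← LinearMap.IsAlt.neg halt₂, ← hT, LinearMap.IsAlt.neg halt₁]
  have hTcomm : ∀ g, Commute (ρ₁ g) T := fun g => by
    ext u
    refine hinj (LinearMap.ext fun v => ?_)
    have hv : ρ₁ g (ρ₁ g⁻¹ v) = v := ρ₁.self_inv_apply g v
    rw [← hv]
    simp only [Module.End.mul_apply, hinv₁, hT, he, hinv₂]
  obtain ⟨q, hq⟩ := T.exists_aeval_sq_eq hTinj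
  have hadj := hTadj.aeval_self q
  have hcomm : ∀ g, Commute (ρ₁ g) (Polynomial.aeval T q) := fun g =>
    Algebra.commute_of_mem_adjoin_singleton_of_commute (Polynomial.aeval_mem_adjoin_singleton 𝕜 T)
      (hTcomm g)
  set S := Polynomial.aeval T q
  have hSS : ∀ u, S (S u) = T u := fun u => by rw [← Module.End.mul_apply, ← sq, hq]
  have hSinj : Function.Injective S := fun u v h => hTinj (by rw [← hSS, ← hSS, h])
  let E : V₁ ≃ₗ[𝕜] V₁ := LinearEquiv.ofInjectiveEndo S hSinj
  have hE : ∀ u, S (E.symm u) = u := E.apply_symm_apply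
  refine ⟨E.symm.trans e, fun g v => ?_, fun u v => ?_⟩
  · have : E.symm (ρ₁ g v) = ρ₁ g (E.symm v) := hSinj <| by
      rw [hE, ← Module.End.mul_apply, ← (hcomm g).eq, Module.End.mul_apply, hE]
    simp [this, he]
  · rw [LinearEquiv.trans_apply, LinearEquiv.trans_apply, ← hT, ← hSS, hadj, hE, hE]
end
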